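/- Let (W,U) be a graphon game and f a Nash equilibrium of (W,U). Let {(W_n,U_n)} be a sequence of graphon games and {f_n} a sequence of strategy profiles such that W_n → W a.e. on (0,1]², U_n(t) → U(t) in the norm of C for a.e. t, and f_n(t) → f(t) in norm for a.e. t. Then there exists a sequence {ε_n} of nonnegative reals with ε_n → 0 such that f_n is an ε_n-Nash equilibrium of (W_n,U_n) for every n. -/

import Mathlib

open MeasureTheory Set Filter Topology

noncomputable section

variable {E : Type*} [NormedAddCommGroup E] [NormedSpace ℝ E]

/-- The common strategy set `S`, viewed as a subset of `E` with the weak topology. -/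
def weakS (S : Set E) : Set (WeakSpace ℝ E) := toWeakSpace ℝ E '' S

/-- The Banach space `C` of real-valued functions on `S × S` that are continuous for the
weak topology of `S`, with the supremum norm. (Since `S` is weakly compact, these are
exactly the bounded continuous functions on `S × S` with the weak topology.) -/
abbrev CGame (S : Set E) := BoundedContinuousFunction (↥(weakS S) × ↥(weakS S)) ℝ

/-- An element of `S`, as a point of `S` with the weak topology. -/
def memWeakS {S : Set E} {a : E} (ha : a ∈ S) : ↥(weakS S) :=
  ⟨toWeakSpace ℝ E a, a, ha, rfl⟩

/-- The agent space `(0,1]` with Lebesgue measure. -/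
def μ01 : Measure ℝ := volume.restrict (Set.Ioc (0 : ℝ) 1)

/-- Lebesgue measure on `(0,1]²`. -/
def μ01sq : Measure (ℝ × ℝ) := volume.restrict ((Set.Ioc (0 : ℝ) 1) ×ˢ (Set.Ioc (0 : ℝ) 1))

/-- The local aggregate `∫ W(t,s) f(s) dμ(s)` of a strategy profile `f`. -/
def agg (W : ℝ → ℝ → ℝ) (f : ℝ → E) (t : ℝ) : E := ∫ s, W t s • f s ∂μ01

/-- `(W, U)` is a graphon game: `W` is a graphon on `(0,1]` and `U` is a measurable map
from `(0,1]` to the closed unit ball `C₀` of `C`. -/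
def IsGraphonGame (S : Set E) (W : ℝ → ℝ → ℝ) (U : ℝ → CGame S) : Prop :=
  Measurable (Function.uncurry W) ∧
  (∀ t ∈ Set.Ioc (0 : ℝ) 1, ∀ s ∈ Set.Ioc (0 : ℝ) 1, W t s ∈ Set.Icc (0 : ℝ) 1) ∧
  StronglyMeasurable U ∧ (∀ t, ‖U t‖ ≤ 1)

/-- A strategy profile of a graphon game: a measurable function from agents to `S`. -/
def IsProfile (S : Set E) (f : ℝ → E) : Prop :=
  StronglyMeasurable f ∧ ∀ t, f t ∈ S

/-- `f` is a Nash equilibrium of the graphon game `(W, U)`: for a.e. agent `t`, `f t`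
maximizes `a ↦ U t (a, agg W f t)` over `S`. (The membership facts `f t ∈ S` and
`agg W f t ∈ S`, which always hold for strategy profiles since `S` is closed convex and
contains `0`, are quantified universally so that the utility can be evaluated.) -/
def IsNashEq (S : Set E) (W : ℝ → ℝ → ℝ) (U : ℝ → CGame S) (f : ℝ → E) : Prop :=
  ∀ᵐ t ∂μ01, ∀ (hft : f t ∈ S) (hag : agg W f t ∈ S), ∀ a, ∀ ha : a ∈ S,
    U t (memWeakS ha, memWeakS hag) ≤ U t (memWeakS hft, memWeakS hag)

/-- `f` is an `ε`-Nash equilibrium of the graphon game `(W, U)`: the set of agents whose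
strategy is `ε`-optimal has measure at least `1 - ε`. -/
def IsEpsNashEq (S : Set E) (W : ℝ → ℝ → ℝ) (U : ℝ → CGame S) (f : ℝ → E) (ε : ℝ) : Prop :=
  ENNReal.ofReal (1 - ε) ≤
    μ01 {t : ℝ | ∀ (hft : f t ∈ S) (hag : agg W f t ∈ S), ∀ a, ∀ ha : a ∈ S,
      U t (memWeakS ha, memWeakS hag) - ε ≤ U t (memWeakS hft, memWeakS hag)}

/-- A network game with `m` players, common strategy set `S`, adjacency matrix `A` with
entries in `[0,1]` and utility functions `v i` in the unit ball `C₀` of `C`. -/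
def IsNetworkGame (S : Set E) (m : ℕ) (A : Fin m → Fin m → ℝ) (v : Fin m → CGame S) : Prop :=
  0 < m ∧ (∀ i j, A i j ∈ Set.Icc (0 : ℝ) 1) ∧ (∀ i, ‖v i‖ ≤ 1)

/-- The local aggregate `m⁻¹ Σ_j A i j • s j` of player `i` in a network game. -/
def netAgg (m : ℕ) (A : Fin m → Fin m → ℝ) (s : Fin m → E) (i : Fin m) : E :=
  (m : ℝ)⁻¹ • ∑ j, A i j • s j

/-- `s` is an `ε`-Nash equilibrium of the network game `(m, A, v)`: the proportion of
players whose strategy is `ε`-optimal is at least `1 - ε`. -/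
def IsNetEpsNashEq (S : Set E) (m : ℕ) (A : Fin m → Fin m → ℝ) (v : Fin m → CGame S)
    (s : Fin m → E) (ε : ℝ) : Prop :=
  1 - ε ≤ (({i : Fin m | ∀ (hsi : s i ∈ S) (hag : netAgg m A s i ∈ S), ∀ a, ∀ ha : a ∈ S,
      v i (memWeakS ha, memWeakS hag) - ε ≤ v i (memWeakS hsi, memWeakS hag)}.ncard : ℝ)) / m

/-- The `m`-step function on `(0,1]` determined by the values `g i` on the intervals
`(i/m, (i+1)/m]`, with default value `x₀` outside `(0,1]`. -/
def stepOf {X : Type*} (m : ℕ) (g : Fin m → X) (x₀ : X) (t : ℝ) : X :=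
  if h : ∃ i : Fin m, t ∈ Set.Ioc ((i : ℝ) / m) (((i : ℝ) + 1) / m) then g h.choose else x₀

/-- The `m`-step graphon `W_A` associated with the adjacency matrix `A`. -/
def stepGraphonOf (m : ℕ) (A : Fin m → Fin m → ℝ) : ℝ → ℝ → ℝ :=
  fun t s => stepOf m (fun i => stepOf m (fun j => A i j) 0 s) 0 t

/-- The `m`-step utility profile `U_v` associated with the utilities `v`. -/
def stepUtilOf {S : Set E} (m : ℕ) (v : Fin m → CGame S) : ℝ → CGame S := stepOf m v 0

/-- The `m`-step strategy profile `f_s` associated with the strategies `s`. -/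
def stepProfileOf (m : ℕ) (s : Fin m → E) : ℝ → E := stepOf m s 0

/-- A sequence of network games `(m n, A n, v n)` converges to the graphon game `(W, U)`:
`W_{A_n} → W` a.e. on `(0,1]²`, `U_{v_n}(t) → U(t)` in the norm of `C` for a.e. `t`, and
the number of players tends to infinity. -/
def NetGamesTendsto (S : Set E) (m : ℕ → ℕ) (A : ∀ n, Fin (m n) → Fin (m n) → ℝ)
    (v : ∀ n, Fin (m n) → CGame S) (W : ℝ → ℝ → ℝ) (U : ℝ → CGame S) : Prop :=
  (∀ᵐ p ∂μ01sq, Tendsto (fun n => stepGraphonOf (m n) (A n) p.1 p.2) atTop (𝓝 (W p.1 p.2))) ∧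
  (∀ᵐ t ∂μ01, Tendsto (fun n => stepUtilOf (m n) (v n) t) atTop (𝓝 (U t))) ∧
  Tendsto m atTop atTop

end

theorem isBounded_of_isCompact_weakS {E : Type*} [NormedAddCommGroup E] [NormedSpace ℝ E]
    {S : Set E} (hS : IsCompact (weakS S)) : ∃ C : ℝ, ∀ x ∈ S, ‖x‖ ≤ C := by
  obtain ⟨C, hC⟩ := banach_steinhaus
    (g := fun x : S => NormedSpace.inclusionInDoubleDual ℝ E (x : E)) (fun φ => by
      have hcont : Continuous fun x : WeakSpace ℝ E => φ ((toWeakSpace ℝ E).symm x) :=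
        WeakBilin.eval_continuous _ φ
      obtain ⟨C, hC⟩ := hS.exists_bound_of_continuousOn hcont.continuousOn
      exact ⟨C, fun x => hC _ ⟨x, x.2, rfl⟩⟩)
  refine ⟨C, fun x hx => ?_⟩
  have h := hC ⟨x, hx⟩
  rwa [← (NormedSpace.inclusionInDoubleDualLi ℝ).norm_map x]

theorem isClosed_of_isCompact_weakS {E : Type*} [NormedAddCommGroup E] [NormedSpace ℝ E]
    {S : Set E} (hS : IsCompact (weakS S)) : IsClosed S := by
  have h := hS.isClosed.preimage (toWeakSpaceCLM ℝ E).continuous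
  convert h
  exact ((toWeakSpace ℝ E).injective.preimage_image S).symm

instance isProbabilityMeasure_μ01 : IsProbabilityMeasure μ01 :=
  ⟨by simp [μ01]⟩

theorem ae_mem_Ioc_μ01 : ∀ᵐ t ∂μ01, t ∈ Set.Ioc (0 : ℝ) 1 :=
  ae_restrict_mem measurableSet_Ioc

theorem μ01sq_eq_prod : μ01sq = μ01.prod μ01 := by
  rw [μ01sq, μ01, Measure.prod_restrict, Measure.volume_eq_prod]

theorem aestronglyMeasurable_smul_profile {E : Type*} [NormedAddCommGroup E] [NormedSpace ℝ E]
    {S : Set E} {W : ℝ → ℝ → ℝ} {f : ℝ → E} (hW : Measurable (Function.uncurry W))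
    (hf : IsProfile S f) (t : ℝ) :
    AEStronglyMeasurable (fun s => W t s • f s) μ01 :=
  ((hW.comp measurable_prodMk_left).stronglyMeasurable.smul hf.1).aestronglyMeasurable

theorem norm_smul_profile_le {E : Type*} [NormedAddCommGroup E] [NormedSpace ℝ E]
    {S : Set E} {C : ℝ} (hC : ∀ x ∈ S, ‖x‖ ≤ C) {w : ℝ} (hw : w ∈ Set.Icc (0 : ℝ) 1)
    {x : E} (hx : x ∈ S) : ‖w • x‖ ≤ C := by
  rw [norm_smul, Real.norm_of_nonneg hw.1]
  exact (mul_le_of_le_one_left (norm_nonneg x) hw.2).trans (hC x hx)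

theorem agg_mem {E : Type*} [NormedAddCommGroup E] [NormedSpace ℝ E] [CompleteSpace E]
    {S : Set E} (hS0 : (0 : E) ∈ S) (hSconv : Convex ℝ S) (hS : IsCompact (weakS S))
    {W : ℝ → ℝ → ℝ} {U : ℝ → CGame S} (hG : IsGraphonGame S W U)
    {f : ℝ → E} (hf : IsProfile S f) {t : ℝ} (ht : t ∈ Set.Ioc (0 : ℝ) 1) :
    agg W f t ∈ S := by
  obtain ⟨C, hC⟩ := isBounded_of_isCompact_weakS hS
  refine hSconv.integral_mem (isClosed_of_isCompact_weakS hS) ?_ ?_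
  · filter_upwards [ae_mem_Ioc_μ01] with s hs
    exact hSconv.smul_mem_of_zero_mem hS0 (hf.2 s) (hG.2.1 t ht s hs)
  · refine Integrable.of_bound (aestronglyMeasurable_smul_profile hG.1 hf t) C ?_
    filter_upwards [ae_mem_Ioc_μ01] with s hs
    exact norm_smul_profile_le hC (hG.2.1 t ht s hs) (hf.2 s)

/-- Local aggregates depend continuously on the graphon and the profile, for a.e. agent. -/
theorem ae_tendsto_agg {E : Type*} [NormedAddCommGroup E] [NormedSpace ℝ E]
    {S : Set E} (hS : IsCompact (weakS S)) {W : ℝ → ℝ → ℝ} {f : ℝ → E}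
    {Wn : ℕ → ℝ → ℝ → ℝ} {Un : ℕ → ℝ → CGame S} (hGn : ∀ n, IsGraphonGame S (Wn n) (Un n))
    {fn : ℕ → ℝ → E} (hfn : ∀ n, IsProfile S (fn n))
    (hWconv : ∀ᵐ p ∂μ01sq, Tendsto (fun n => Wn n p.1 p.2) atTop (𝓝 (W p.1 p.2)))
    (hfconv : ∀ᵐ t ∂μ01, Tendsto (fun n => fn n t) atTop (𝓝 (f t))) :
    ∀ᵐ t ∂μ01, Tendsto (fun n => agg (Wn n) (fn n) t) atTop (𝓝 (agg W f t)) := by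
  obtain ⟨C, hC⟩ := isBounded_of_isCompact_weakS hS
  rw [μ01sq_eq_prod] at hWconv
  filter_upwards [Measure.ae_ae_of_ae_prod hWconv, ae_mem_Ioc_μ01] with t hWt ht
  refine tendsto_integral_of_dominated_convergence (fun _ => C)
    (fun n => aestronglyMeasurable_smul_profile (hGn n).1 (hfn n) t) (integrable_const C)
    (fun n => ?_) ?_
  · filter_upwards [ae_mem_Ioc_μ01] with s hs
    exact norm_smul_profile_le hC ((hGn n).2.1 t ht s hs) ((hfn n).2 s)
  · filter_upwards [hWt, hfconv] with s hWs hfs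
    exact hWs.smul hfs

theorem tendsto_memWeakS {E : Type*} [NormedAddCommGroup E] [NormedSpace ℝ E] {S : Set E}
    {u : ℕ → E} {a : E} (hu : ∀ n, u n ∈ S) (ha : a ∈ S) (h : Tendsto u atTop (𝓝 a)) :
    Tendsto (fun n => memWeakS (hu n)) atTop (𝓝 (memWeakS ha)) :=
  tendsto_subtype_rng.2 (((toWeakSpaceCLM ℝ E).continuous.tendsto a).comp h)

/-- A maximizer of a payoff is asymptotically optimal along convergent payoffs and strategies,
uniformly in the deviation. -/
theorem eventually_forall_payoff_sub_lt {X Y ι : Type*} [TopologicalSpace X] [CompactSpace X]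
    [TopologicalSpace Y] {l : Filter ι} {u : BoundedContinuousFunction (X × Y) ℝ}
    {un : ι → BoundedContinuousFunction (X × Y) ℝ} {x : X} {xn : ι → X} {y : Y} {yn : ι → Y}
    (hu : Tendsto un l (𝓝 u)) (hx : Tendsto xn l (𝓝 x)) (hy : Tendsto yn l (𝓝 y))
    (hmax : ∀ a, u (a, y) ≤ u (x, y)) {η : ℝ} (hη : 0 < η) :
    ∀ᶠ n in l, ∀ a, un n (a, yn n) - un n (xn n, yn n) < η := by
  have hcont : Continuous fun z : (BoundedContinuousFunction (X × Y) ℝ × X × Y) × X =>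
      z.1.1 (z.2, z.1.2.2) - z.1.1 (z.1.2.1, z.1.2.2) :=
    (continuous_eval.comp (by fun_prop : Continuous fun
      z : (BoundedContinuousFunction (X × Y) ℝ × X × Y) × X => (z.1.1, (z.2, z.1.2.2)))).sub
    (continuous_eval.comp (by fun_prop : Continuous fun
      z : (BoundedContinuousFunction (X × Y) ℝ × X × Y) × X => (z.1.1, (z.1.2.1, z.1.2.2))))
  have key : ∀ᶠ p in 𝓝 (u, x, y), ∀ a ∈ (Set.univ : Set X),
      p.1 (a, p.2.2) - p.1 (p.2.1, p.2.2) < η :=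
    isCompact_univ.eventually_forall_of_forall_eventually fun a _ =>
      hcont.continuousAt.eventually_lt_const
        (lt_of_le_of_lt (sub_nonpos.2 (hmax a)) hη)
  filter_upwards [(hu.prodMk_nhds (hx.prodMk_nhds hy)).eventually key] with n hn a
  exact hn a (Set.mem_univ a)

/-- Almost everywhere eventual truth implies that the (outer) measures of the sets of truth
eventually exceed any number below the total mass. -/
theorem eventually_lt_measure_of_ae_eventually {α : Type*} [MeasurableSpace α] {μ : Measure α}
    {p : ℕ → α → Prop} (hp : ∀ᵐ t ∂μ, ∀ᶠ n in atTop, p n t) {c : ENNReal}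
    (hc : c < μ Set.univ) : ∀ᶠ n in atTop, c < μ {t | p n t} := by
  have hmono : Monotone fun N : ℕ => {t | ∀ n ≥ N, p n t} :=
    fun _ _ hNM _ ht n hn => ht n (hNM.trans hn)
  have hunion : μ (⋃ N : ℕ, {t | ∀ n ≥ N, p n t}) = μ Set.univ := by
    refine measure_congr (Filter.eventuallyEq_univ.2 ?_)
    filter_upwards [hp] with t ht
    exact Set.mem_iUnion.2 (eventually_atTop.1 ht)
  rw [← hunion] at hc
  filter_upwards [(tendsto_measure_iUnion_atTop hmono).eventually_const_lt hc] with n hn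
  exact hn.trans_le (measure_mono fun t ht => ht n le_rfl)

theorem IsEpsNashEq.mono {E : Type*} [NormedAddCommGroup E] [NormedSpace ℝ E] {S : Set E}
    {W : ℝ → ℝ → ℝ} {U : ℝ → CGame S} {f : ℝ → E} {ε δ : ℝ} (h : IsEpsNashEq S W U f ε)
    (hεδ : ε ≤ δ) : IsEpsNashEq S W U f δ :=
  (ENNReal.ofReal_le_ofReal (sub_le_sub_left hεδ 1)).trans <| h.trans <| measure_mono
    fun _ ht hft hag a ha => (sub_le_sub_left hεδ _).trans (ht hft hag a ha)

theorem isEpsNashEq_one {E : Type*} [NormedAddCommGroup E] [NormedSpace ℝ E] (S : Set E)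
    (W : ℝ → ℝ → ℝ) (U : ℝ → CGame S) (f : ℝ → E) : IsEpsNashEq S W U f 1 := by
  simp [IsEpsNashEq]

theorem exists_tendsto_zero_of_eventually {P : ℕ → ℝ → Prop}
    (hmono : ∀ n ε δ, P n ε → ε ≤ δ → P n δ) (hone : ∀ n, P n 1)
    (hP : ∀ ε > 0, ∀ᶠ n in atTop, P n ε) :
    ∃ ε : ℕ → ℝ, (∀ n, 0 ≤ ε n) ∧ (∀ n, P n (ε n)) ∧ Tendsto ε atTop (𝓝 0) := by
  have hbdd : ∀ n, BddBelow {ε | 0 ≤ ε ∧ P n ε} := fun n => ⟨0, fun _ h => h.1⟩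
  have hinf : ∀ n, 0 ≤ sInf {ε | 0 ≤ ε ∧ P n ε} := fun n => Real.sInf_nonneg fun _ h => h.1
  have hpos : ∀ n : ℕ, (0 : ℝ) < 1 / (n + 1) := fun n => Nat.one_div_pos_of_nat
  refine ⟨fun n => sInf {ε | 0 ≤ ε ∧ P n ε} + 1 / (n + 1),
    fun n => add_nonneg (hinf n) (hpos n).le, fun n => ?_, ?_⟩
  · obtain ⟨ε, hε, hlt⟩ := Real.lt_sInf_add_pos (s := {ε | 0 ≤ ε ∧ P n ε})
      ⟨1, zero_le_one, hone n⟩ (hpos n)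
    exact hmono n ε _ hε.2 hlt.le
  · have h0 : Tendsto (fun n => sInf {ε | 0 ≤ ε ∧ P n ε}) atTop (𝓝 0) := by
      refine tendsto_order.2 ⟨fun a ha => Eventually.of_forall fun n => ha.trans_le (hinf n),
        fun a ha => ?_⟩
      filter_upwards [hP (a / 2) (half_pos ha)] with n hn
      exact (csInf_le (hbdd n) ⟨(half_pos ha).le, hn⟩).trans_lt (half_lt_self ha)
    simpa using h0.add tendsto_one_div_add_atTop_nhds_zero_nat

/-- **Nash equilibria are limits of asymptotic Nash equilibria** (Theorem 3 of the
paper). If `f` is a Nash equilibrium of the graphon game `(W, U)` and a sequence of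
graphon games `(W_n, U_n)` with profiles `f_n` converges to `(W, U)` and `f` (a.e.),
then there are `ε_n → 0` such that each `f_n` is an `ε_n`-Nash equilibrium of
`(W_n, U_n)`. -/
theorem nash_is_limit_of_asymptotic_nash
    {E : Type*} [NormedAddCommGroup E] [NormedSpace ℝ E] [CompleteSpace E]
    [TopologicalSpace.SeparableSpace E]
    (S : Set E) (hS0 : (0 : E) ∈ S) (hSconv : Convex ℝ S) (hScomp : IsCompact (weakS S))
    (W : ℝ → ℝ → ℝ) (U : ℝ → CGame S) (hG : IsGraphonGame S W U)
    (f : ℝ → E) (hf : IsProfile S f) (hfNash : IsNashEq S W U f)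
    (Wn : ℕ → ℝ → ℝ → ℝ) (Un : ℕ → ℝ → CGame S)
    (hGn : ∀ n, IsGraphonGame S (Wn n) (Un n))
    (fn : ℕ → ℝ → E) (hfn : ∀ n, IsProfile S (fn n))
    (hWconv : ∀ᵐ p ∂μ01sq, Tendsto (fun n => Wn n p.1 p.2) atTop (𝓝 (W p.1 p.2)))
    (hUconv : ∀ᵐ t ∂μ01, Tendsto (fun n => Un n t) atTop (𝓝 (U t)))
    (hfconv : ∀ᵐ t ∂μ01, Tendsto (fun n => fn n t) atTop (𝓝 (f t))) :
    ∃ ε : ℕ → ℝ, (∀ n, 0 ≤ ε n) ∧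
      (∀ n, IsEpsNashEq S (Wn n) (Un n) (fn n) (ε n)) ∧
      Tendsto ε atTop (𝓝 0) := by
  refine exists_tendsto_zero_of_eventually (P := fun n ε => IsEpsNashEq S (Wn n) (Un n) (fn n) ε)
    (fun n ε δ h => h.mono) (fun n => isEpsNashEq_one _ _ _ _) fun η hη => ?_
  have : CompactSpace ↥(weakS S) := isCompact_iff_compactSpace.1 hScomp
  have hae : ∀ᵐ t ∂μ01, ∀ᶠ n in atTop, ∀ (hft : fn n t ∈ S) (hag : agg (Wn n) (fn n) t ∈ S),
      ∀ a, ∀ ha : a ∈ S, Un n t (memWeakS ha, memWeakS hag) - η ≤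
        Un n t (memWeakS hft, memWeakS hag) := by
    filter_upwards [ae_tendsto_agg hScomp hGn hfn hWconv hfconv, hfNash, hUconv, hfconv,
      ae_mem_Ioc_μ01] with t hagg hN hUt hft ht
    have hfS := hf.2 t
    have hgS := agg_mem hS0 hSconv hScomp hG hf ht
    have hgnS := fun n => agg_mem hS0 hSconv hScomp (hGn n) (hfn n) ht
    filter_upwards [eventually_forall_payoff_sub_lt hUt
      (tendsto_memWeakS (fun n => (hfn n).2 t) hfS hft) (tendsto_memWeakS hgnS hgS hagg)
      (by rintro ⟨_, a, ha, rfl⟩; exact hN hfS hgS a ha) hη] with n hn _ _ a ha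
    linarith [hn (memWeakS ha)]
  have hlt : ENNReal.ofReal (1 - η) < μ01 Set.univ := by
    rw [measure_univ, ENNReal.ofReal_lt_one]
    linarith
  exact (eventually_lt_measure_of_ae_eventually hae hlt).mono fun n hn => hn.le
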